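/- Let 0 < H < 1 and define R(s,t) = s^{2H} + t^{2H} − ½((s + t)^{2H} + |t − s|^{2H}) (the covariance of sub-fractional Brownian motion with parameter H). Then for any n ≥ 1 and any strictly increasing times 0 < t₁ < t₂ < ⋯ < t_n, the n×n matrix V with entries V_{ij} = R(t_i, t_j) is strictly positive definite. -/

import Mathlib

open Matrix Real

open MeasureTheory Set

lemma integrableOn_one_sub_cos_mul_rpow {H : ℝ} (hH0 : 0 < H) (hH1 : H < 1) (x : ℝ) :
    IntegrableOn (fun u : ℝ => (1 - cos (u * x)) * u ^ (-1 - 2 * H)) (Ioi 0) := by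
  have hmeas : Measurable fun u : ℝ => (1 - cos (u * x)) * u ^ (-1 - 2 * H) := by fun_prop
  rw [← Ioc_union_Ioi_eq_Ioi zero_le_one]
  refine IntegrableOn.union ?_ ?_
  · have hdom : IntegrableOn (fun u : ℝ => x ^ 2 / 2 * u ^ (1 - 2 * H)) (Ioc 0 1) :=
      ((intervalIntegrable_iff_integrableOn_Ioc_of_le zero_le_one).1
        (intervalIntegral.intervalIntegrable_rpow' (by linarith))).const_mul _
    refine hdom.mono' hmeas.aestronglyMeasurable ?_
    filter_upwards [ae_restrict_mem measurableSet_Ioc] with u hu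
    have hpow : u ^ (1 - 2 * H) = u ^ 2 * u ^ (-1 - 2 * H) := by
      rw [← rpow_natCast, ← rpow_add hu.1]
      congr 1
      push_cast
      ring
    have hw := rpow_nonneg hu.1.le (-1 - 2 * H)
    rw [norm_of_nonneg (mul_nonneg (by linarith [cos_le_one (u * x)]) hw), hpow, ← mul_assoc]
    refine mul_le_mul_of_nonneg_right ?_ hw
    linarith [one_sub_sq_div_two_le_cos (x := u * x), mul_pow u x 2]
  · have hdom : IntegrableOn (fun u : ℝ => 2 * u ^ (-1 - 2 * H)) (Ioi 1) :=
      (integrableOn_Ioi_rpow_of_lt (by linarith) one_pos).const_mul _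
    refine hdom.mono' hmeas.aestronglyMeasurable ?_
    filter_upwards [ae_restrict_mem measurableSet_Ioi] with u hu
    have hw := rpow_nonneg (zero_le_one.trans (le_of_lt hu)) (-1 - 2 * H)
    rw [norm_of_nonneg (mul_nonneg (by linarith [cos_le_one (u * x)]) hw)]
    exact mul_le_mul_of_nonneg_right (by linarith [neg_one_le_cos (u * x)]) hw

lemma integral_one_sub_cos_mul_rpow {H : ℝ} (hH0 : 0 < H) {x : ℝ} (hx : 0 ≤ x) :
    ∫ u in Ioi (0 : ℝ), (1 - cos (u * x)) * u ^ (-1 - 2 * H) =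
      (∫ u in Ioi (0 : ℝ), (1 - cos u) * u ^ (-1 - 2 * H)) * x ^ (2 * H) := by
  rcases hx.eq_or_lt with rfl | hx
  · simp [zero_rpow (mul_pos two_pos hH0).ne']
  have hscale := integral_comp_mul_right_Ioi
    (fun u : ℝ => (1 - cos u) * u ^ (-1 - 2 * H)) 0 hx
  have hcongr : ∫ u in Ioi (0 : ℝ), (1 - cos (u * x)) * (u * x) ^ (-1 - 2 * H) =
      ∫ u in Ioi (0 : ℝ), x ^ (-1 - 2 * H) * ((1 - cos (u * x)) * u ^ (-1 - 2 * H)) := by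
    refine setIntegral_congr_fun measurableSet_Ioi fun u hu => ?_
    simp only [mul_rpow (le_of_lt hu) hx.le]
    ring
  have hpow : x⁻¹ = x ^ (2 * H) * x ^ (-1 - 2 * H) := by
    rw [← rpow_add hx, ← rpow_neg_one]
    congr 1
    ring
  rw [hcongr, integral_const_mul, zero_mul, smul_eq_mul, hpow] at hscale
  refine mul_left_cancel₀ (rpow_pos_of_pos hx (-1 - 2 * H)).ne' ?_
  rw [hscale]
  ring

lemma linearIndependent_cexp_mul_I {ι : Type*} {s : ι → ℝ} (hs : Function.Injective s) :
    LinearIndependent ℂ fun i (u : ℝ) => Complex.exp (u * s i * Complex.I) := by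
  let χ : ι → Multiplicative ℝ →* ℂ := fun i =>
    { toFun := fun u => Complex.exp ((u.toAdd : ℝ) * s i * Complex.I)
      map_one' := by simp
      map_mul' := fun u v => by
        rw [← Complex.exp_add, toAdd_mul]
        push_cast
        ring_nf }
  have hχ : Function.Injective χ := by
    intro i j hij
    have hexp (u : ℝ) : Complex.exp (u * s i * Complex.I) = Complex.exp (u * s j * Complex.I) :=
      DFunLike.congr_fun hij (Multiplicative.ofAdd u)
    have hd (k : ι) : HasDerivAt (fun u : ℝ => Complex.exp (u * s k * Complex.I))
        (s k * Complex.I) 0 := by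
      have := (((hasDerivAt_id (0 : ℝ)).ofReal_comp.mul_const (s k : ℂ)).mul_const
        Complex.I).cexp
      simpa using this
    have := (hd i).unique (by simpa only [hexp] using hd j)
    exact hs (by simpa using this)
  exact (linearIndependent_monoidHom (Multiplicative ℝ) ℂ).comp χ hχ

lemma eq_zero_of_sum_mul_one_sub_cos_eq_zero {ι : Type*} [Fintype ι] {t a : ι → ℝ}
    (hpos : ∀ i, 0 < t i) (ht : Function.Injective t)
    (h : ∀ u : ℝ, ∑ i, a i * (1 - cos (u * t i)) = 0) : a = 0 := by
  let s : ι ⊕ ι ⊕ Unit → ℝ := Sum.elim t (Sum.elim (fun i => -t i) 0)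
  have hs : Function.Injective s := by
    refine ht.sumElim (Function.Injective.sumElim (fun i j hij => ht (neg_injective hij))
      (Function.injective_of_subsingleton _) ?_) ?_
    · intro i _
      simpa using (hpos i).ne'
    · rintro i (j | _)
      · simpa using ((neg_neg_of_pos (hpos j)).trans (hpos i)).ne'
      · simpa using (hpos i).ne'
  let c : ι ⊕ ι ⊕ Unit → ℂ :=
    Sum.elim (fun i => a i) (Sum.elim (fun i => a i) fun _ => -2 * ∑ i, (a i : ℂ))
  have hc := Fintype.linearIndependent_iff.1 (linearIndependent_cexp_mul_I hs) c (by
    ext u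
    have hu := congrArg (fun r : ℝ => (-2 : ℂ) * r) (h u)
    simp only [Complex.ofReal_sum, Complex.ofReal_mul, Complex.ofReal_sub, Complex.ofReal_one,
      Complex.ofReal_cos, Complex.ofReal_zero, mul_zero, Complex.cos] at hu
    simp only [Fintype.sum_sum_type, c, s, Sum.elim_inl, Sum.elim_inr, Finset.univ_unique,
      Finset.sum_singleton, Finset.sum_apply, Pi.smul_apply, smul_eq_mul,
      Pi.zero_apply, Complex.ofReal_zero, Complex.ofReal_neg, mul_zero, zero_mul,
      Complex.exp_zero, mul_one]
    rw [← hu, Finset.mul_sum, Finset.mul_sum, ← Finset.sum_add_distrib, ← Finset.sum_add_distrib]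
    refine Finset.sum_congr rfl fun i _ => ?_
    rw [show (u : ℂ) * -(t i : ℂ) * Complex.I = -(u * t i) * Complex.I by ring]
    ring)
  ext i
  simpa [c] using hc (Sum.inl i)

lemma integral_sq_mul_rpow_pos {H : ℝ} {ι : Type*} [Fintype ι] {t a : ι → ℝ}
    (hpos : ∀ i, 0 < t i) (ht : Function.Injective t) (ha : a ≠ 0)
    (hint : IntegrableOn
      (fun u : ℝ => (∑ i, a i * (1 - cos (u * t i))) ^ 2 * u ^ (-1 - 2 * H)) (Ioi 0)) :
    0 < ∫ u in Ioi (0 : ℝ), (∑ i, a i * (1 - cos (u * t i))) ^ 2 * u ^ (-1 - 2 * H) := by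
  have hnonneg : ∀ u ∈ Ioi (0 : ℝ),
      0 ≤ (∑ i, a i * (1 - cos (u * t i))) ^ 2 * u ^ (-1 - 2 * H) :=
    fun u hu => mul_nonneg (sq_nonneg _) (rpow_nonneg (le_of_lt hu) _)
  refine (setIntegral_nonneg measurableSet_Ioi hnonneg).lt_of_ne fun hzero => ha ?_
  have hae := (setIntegral_eq_zero_iff_of_nonneg_ae
    (ae_restrict_of_forall_mem measurableSet_Ioi hnonneg) hint).1 hzero.symm
  have hEq := Measure.eqOn_open_of_ae_eq hae isOpen_Ioi
    (ContinuousOn.mul (by fun_prop) fun u hu =>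
      (continuousAt_rpow_const u _ (Or.inl (ne_of_gt hu))).continuousWithinAt)
    continuousOn_const
  have hvan : ∀ u > 0, ∑ i, a i * (1 - cos (u * t i)) = 0 := fun u hu => by
    simpa [(rpow_pos_of_pos hu (-1 - 2 * H)).ne'] using hEq hu
  refine eq_zero_of_sum_mul_one_sub_cos_eq_zero hpos ht fun u => ?_
  rcases lt_trichotomy u 0 with hu | rfl | hu
  · simpa using hvan (-u) (neg_pos.2 hu)
  · simp
  · exact hvan u hu

lemma one_sub_cos_mul_one_sub_cos (x y : ℝ) :
    (1 - cos x) * (1 - cos y) =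
      (1 - cos x) + (1 - cos y) - 1 / 2 * ((1 - cos (x + y)) + (1 - cos (y - x))) := by
  rw [cos_add, cos_sub]
  ring

lemma one_sub_cos_prod_mul_rpow (H s t u : ℝ) :
    (1 - cos (u * s)) * (1 - cos (u * t)) * u ^ (-1 - 2 * H) =
      (1 - cos (u * s)) * u ^ (-1 - 2 * H) + (1 - cos (u * t)) * u ^ (-1 - 2 * H)
        - 1 / 2 * ((1 - cos (u * (s + t))) * u ^ (-1 - 2 * H)
          + (1 - cos (u * |t - s|)) * u ^ (-1 - 2 * H)) := by
  have habs : cos (u * |t - s|) = cos (u * t - u * s) := by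
    rw [← mul_sub]
    rcases abs_choice (t - s) with h | h <;> rw [h]
    rw [mul_neg, cos_neg]
  rw [one_sub_cos_mul_one_sub_cos, habs, mul_add u s t]
  ring

lemma integrableOn_one_sub_cos_prod_mul_rpow {H : ℝ} (hH0 : 0 < H) (hH1 : H < 1) (s t : ℝ) :
    IntegrableOn (fun u : ℝ => (1 - cos (u * s)) * (1 - cos (u * t)) * u ^ (-1 - 2 * H))
      (Ioi 0) := by
  have hI := integrableOn_one_sub_cos_mul_rpow hH0 hH1
  simp only [one_sub_cos_prod_mul_rpow]
  exact ((hI s).add (hI t)).sub (((hI (s + t)).add (hI |t - s|)).const_mul _)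

lemma integral_one_sub_cos_prod_mul_rpow {H : ℝ} (hH0 : 0 < H) (hH1 : H < 1) {s t : ℝ}
    (hs : 0 ≤ s) (ht : 0 ≤ t) :
    ∫ u in Ioi (0 : ℝ), (1 - cos (u * s)) * (1 - cos (u * t)) * u ^ (-1 - 2 * H) =
      (∫ u in Ioi (0 : ℝ), (1 - cos u) * u ^ (-1 - 2 * H)) *
        (s ^ (2 * H) + t ^ (2 * H) - (1 / 2) * ((s + t) ^ (2 * H) + |t - s| ^ (2 * H))) := by
  have hI (x : ℝ) : Integrable (fun u : ℝ => (1 - cos (u * x)) * u ^ (-1 - 2 * H))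
      (volume.restrict (Ioi 0)) :=
    integrableOn_one_sub_cos_mul_rpow hH0 hH1 x
  simp only [one_sub_cos_prod_mul_rpow]
  rw [integral_sub ((hI s).fun_add (hI t)) (((hI (s + t)).fun_add (hI |t - s|)).const_mul _),
    integral_const_mul, integral_add (hI s) (hI t), integral_add (hI (s + t)) (hI |t - s|),
    integral_one_sub_cos_mul_rpow hH0 hs, integral_one_sub_cos_mul_rpow hH0 ht,
    integral_one_sub_cos_mul_rpow hH0 (add_nonneg hs ht),
    integral_one_sub_cos_mul_rpow hH0 (abs_nonneg _)]
  ring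

theorem sub_fbm_covariance_matrix_posDef (H : ℝ) (hH0 : 0 < H) (hH1 : H < 1)
    (n : ℕ) (hn : 1 ≤ n) (t : Fin n → ℝ)
    (hpos : ∀ i, 0 < t i) (hmono : StrictMono t) :
    (Matrix.of fun i j : Fin n =>
      (t i) ^ (2 * H) + (t j) ^ (2 * H)
        - (1 / 2) * ((t i + t j) ^ (2 * H) + |t j - t i| ^ (2 * H))).PosDef := by
  refine PosDef.of_dotProduct_mulVec_pos ?_ fun a ha => ?_
  · ext i j
    simp only [conjTranspose_apply, of_apply, star_trivial]
    rw [abs_sub_comm, add_comm (t j) (t i)]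
    ring
  have hI (i j : Fin n) : Integrable
      (fun u : ℝ => a i * a j * ((1 - cos (u * t i)) * (1 - cos (u * t j)) * u ^ (-1 - 2 * H)))
      (volume.restrict (Ioi 0)) :=
    (integrableOn_one_sub_cos_prod_mul_rpow hH0 hH1 (t i) (t j)).const_mul _
  have hexpand (u : ℝ) : (∑ i, a i * (1 - cos (u * t i))) ^ 2 * u ^ (-1 - 2 * H) =
      ∑ i, ∑ j,
        a i * a j * ((1 - cos (u * t i)) * (1 - cos (u * t j)) * u ^ (-1 - 2 * H)) := by
    rw [sq, Finset.sum_mul_sum, Finset.sum_mul]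
    refine Finset.sum_congr rfl fun i _ => ?_
    rw [Finset.sum_mul]
    exact Finset.sum_congr rfl fun j _ => by ring
  have hquad := integral_sq_mul_rpow_pos (H := H) hpos hmono.injective ha (by
    simp only [hexpand]
    exact integrable_finsetSum _ fun i _ => integrable_finsetSum _ fun j _ => hI i j)
  simp only [hexpand] at hquad
  rw [integral_finsetSum _ fun i _ => integrable_finsetSum _ fun j _ => hI i j] at hquad
  simp only [integral_finsetSum _ fun j _ => hI _ j, integral_const_mul,
    integral_one_sub_cos_prod_mul_rpow hH0 hH1 (hpos _).le (hpos _).le] at hquad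
  have hconst : 0 ≤ ∫ u in Ioi (0 : ℝ), (1 - cos u) * u ^ (-1 - 2 * H) :=
    setIntegral_nonneg measurableSet_Ioi fun u hu =>
      mul_nonneg (sub_nonneg.2 (cos_le_one u)) (rpow_nonneg (le_of_lt hu) _)
  refine pos_of_mul_pos_right (lt_of_lt_of_eq hquad ?_) hconst
  simp only [dotProduct, mulVec, of_apply, Pi.star_apply, star_trivial, Finset.mul_sum]
  exact Finset.sum_congr rfl fun i _ => Finset.sum_congr rfl fun j _ => by ring
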